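/- Let 0 < c < 1 and δ₁, δ₂ > 0. Then there exists a positive constant C₃, depending only on δ₁, δ₂ and c, such that for every r > 0, lim_{z₂→∞} e^{z₂/2} · lim_{z₃→0+} z₃^{1−(δ₁+δ₂)/2} · lim_{ε→0+} q(z₂,z₃;ε,z₂·r)/q(z₂;ε,z₂·r) = C₃·D(r)^{−δ₁/2}, where D(r) = 1 + (1−c)/(1−c+c·√r) and q(z₂,z₃;ε,z₁), q(z₂;ε,z₁) are defined in the context. In particular, since r ↦ D(r)^{−δ₁/2} is non-constant on (0,∞), this iterated limit depends on r. -/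

import Mathlib

open MeasureTheory Filter Set Topology

/-- The modified Bessel function of the first kind `I_ν(x)`. -/
noncomputable def besselI (ν x : ℝ) : ℝ :=
  ∑' k : ℕ, (x / 2) ^ (2 * (k : ℝ) + ν) / ((Nat.factorial k : ℝ) * Real.Gamma ((k : ℝ) + ν + 1))

/-- The squared Bessel transition density `p_t^δ(x, y)` for `x, y > 0`. -/
noncomputable def sqBesselP (δ t x y : ℝ) : ℝ :=
  (2 * t)⁻¹ * (y / x) ^ ((δ - 2) / 4) * Real.exp (-(x + y) / (2 * t)) *
    besselI ((δ - 2) / 2) (Real.sqrt (x * y) / t)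

/-- The squared Bessel entrance density from `0`, `p_t^δ(0+, y)`. -/
noncomputable def sqBesselP0 (δ t y : ℝ) : ℝ :=
  y ^ (δ / 2 - 1) / ((2 * t) ^ (δ / 2) * Real.Gamma (δ / 2)) * Real.exp (-y / (2 * t))

/-- The joint density `q(z₂, z₃; ε, z₁)` of `(Z^c(ε), Z^c(1), Z^c(2))`. -/
noncomputable def qThreeE (c δ₁ δ₂ ε z₁ z₂ z₃ : ℝ) : ℝ :=
  ∫ x₁ in Ioo (0 : ℝ) z₁, ∫ x₂ in Ioo (0 : ℝ) z₂, ∫ x₃ in Ioo (0 : ℝ) z₃,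
    sqBesselP0 δ₁ ε x₁ * sqBesselP0 δ₂ ε (z₁ - c * x₁) *
    sqBesselP δ₁ (1 - ε) x₁ x₂ * sqBesselP δ₂ (1 - ε) (z₁ - c * x₁) (z₂ - c * x₂) *
    sqBesselP δ₁ 1 x₂ x₃ * sqBesselP δ₂ 1 (z₂ - c * x₂) (z₃ - c * x₃)

/-- The joint density `q(z₂; ε, z₁)` of `(Z^c(ε), Z^c(1))`. -/
noncomputable def qTwoE (c δ₁ δ₂ ε z₁ z₂ : ℝ) : ℝ :=
  ∫ x₁ in Ioo (0 : ℝ) z₁, ∫ x₂ in Ioo (0 : ℝ) z₂,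
    sqBesselP0 δ₁ ε x₁ * sqBesselP0 δ₂ ε (z₁ - c * x₁) *
    sqBesselP δ₁ (1 - ε) x₁ x₂ * sqBesselP δ₂ (1 - ε) (z₁ - c * x₁) (z₂ - c * x₂)

/-- The limit density `q(z₂, z₃; z₁)` from Lemma 4.2. -/
noncomputable def qThree (c δ₁ δ₂ z₁ z₂ z₃ : ℝ) : ℝ :=
  ∫ x₂ in Ioo (0 : ℝ) z₂, ∫ x₃ in Ioo (0 : ℝ) z₃,
    sqBesselP0 δ₁ 1 x₂ * sqBesselP δ₂ 1 z₁ (z₂ - c * x₂) *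
    sqBesselP δ₁ 1 x₂ x₃ * sqBesselP δ₂ 1 (z₂ - c * x₂) (z₃ - c * x₃)

/-- The limit density `q(z₂; z₁)` from Lemma 4.2. -/
noncomputable def qTwo (c δ₁ δ₂ z₁ z₂ : ℝ) : ℝ :=
  ∫ x₂ in Ioo (0 : ℝ) z₂, sqBesselP0 δ₁ 1 x₂ * sqBesselP δ₂ 1 z₁ (z₂ - c * x₂)

/-- The function `q̃(z₂; z₁)` from Lemma 4.3. -/
noncomputable def qTilde (c δ₁ δ₂ z₁ z₂ : ℝ) : ℝ :=
  ∫ x₂ in Ioo (0 : ℝ) z₂,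
    x₂ ^ (1 - δ₁ / 2) * (z₂ - c * x₂) ^ (1 - δ₂ / 2) *
    sqBesselP0 δ₁ 1 x₂ ^ 2 * sqBesselP δ₂ 1 z₁ (z₂ - c * x₂) * sqBesselP0 δ₂ 1 (z₂ - c * x₂)


/-! ### The entire function `G_ν(s) = ∑ s^k / (k! Γ(k+ν+1))` -/

noncomputable def gCoef (ν : ℝ) (k : ℕ) : ℝ :=
  1 / ((Nat.factorial k : ℝ) * Real.Gamma ((k : ℝ) + ν + 1))

noncomputable def gFun (ν s : ℝ) : ℝ := ∑' k : ℕ, gCoef ν k * s ^ k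

lemma gCoef_pos {ν : ℝ} (hν : -1 < ν) (k : ℕ) : 0 < gCoef ν k := by
  unfold gCoef
  have : 0 < Real.Gamma ((k : ℝ) + ν + 1) :=
    Real.Gamma_pos_of_pos (by have : (0:ℝ) ≤ k := k.cast_nonneg; linarith)
  positivity

lemma gCoef_succ {ν : ℝ} (hν : -1 < ν) (k : ℕ) :
    gCoef ν (k + 1) = gCoef ν k / (((k : ℝ) + 1) * ((k : ℝ) + ν + 1)) := by
  have hk : (0:ℝ) ≤ k := k.cast_nonneg
  have h1 : (k : ℝ) + ν + 1 ≠ 0 := by linarith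
  unfold gCoef
  rw [Nat.factorial_succ]
  push_cast
  rw [show (k : ℝ) + 1 + ν + 1 = ((k : ℝ) + ν + 1) + 1 by ring, Real.Gamma_add_one h1]
  rw [div_div]
  congr 1
  ring

lemma gCoef_succ' {ν : ℝ} (k : ℕ) :
    ((k : ℝ) + 1) * gCoef ν (k + 1) = gCoef (ν + 1) k := by
  unfold gCoef
  rw [Nat.factorial_succ]
  push_cast
  rw [show (k : ℝ) + 1 + ν + 1 = (k : ℝ) + (ν + 1) + 1 by ring]
  have : (k : ℝ) + 1 ≠ 0 := by positivity
  rw [mul_assoc, ← mul_one_div, ← mul_assoc]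
  rw [one_div, mul_inv, one_div]
  field_simp

lemma gSummable {ν : ℝ} (hν : -1 < ν) (s : ℝ) : Summable fun k : ℕ => gCoef ν k * s ^ k := by
  rcases eq_or_ne s 0 with rfl | hs
  · apply summable_of_ne_finset_zero (s := {0})
    intro b hb
    simp at hb
    simp [hb]
  apply summable_of_ratio_test_tendsto_lt_one (l := 0) one_pos
  · exact Eventually.of_forall fun k => mul_ne_zero (gCoef_pos hν k).ne' (pow_ne_zero _ hs)
  · have h1 : Tendsto (fun k : ℕ => |s| * (1 / ((k : ℝ) + 1)) * ((k : ℝ) + (ν + 1))⁻¹) atTop (𝓝 (|s| * 0 * 0)) := by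
      apply Tendsto.mul
      · exact tendsto_one_div_add_atTop_nhds_zero_nat.const_mul _
      · exact tendsto_inv_atTop_zero.comp
          (tendsto_atTop_add_const_right _ _ tendsto_natCast_atTop_atTop)
    simp only [mul_zero] at h1
    refine h1.congr fun k => ?_
    have hk : (0:ℝ) ≤ k := k.cast_nonneg
    have h2 : 0 < (k : ℝ) + ν + 1 := by linarith
    have h3 := gCoef_pos hν k
    rw [gCoef_succ hν, norm_mul, norm_mul, norm_pow, norm_pow, Real.norm_eq_abs, Real.norm_eq_abs,
      Real.norm_eq_abs, abs_div, abs_of_pos h3, abs_of_pos (by positivity : 0 < ((k:ℝ)+1) * ((k:ℝ)+ν+1))]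
    have h4 : |s| ≠ 0 := abs_ne_zero.mpr hs
    rw [show (k:ℝ) + (ν + 1) = k + ν + 1 by ring, pow_succ]
    field_simp

lemma gFun_zero (ν : ℝ) : gFun ν 0 = 1 / Real.Gamma (ν + 1) := by
  unfold gFun
  rw [tsum_eq_single 0]
  · simp [gCoef]
  · intro k hk; simp [hk]

lemma gFun_pos {ν : ℝ} (hν : -1 < ν) {s : ℝ} (hs : 0 ≤ s) : 0 < gFun ν s := by
  unfold gFun
  apply (gSummable hν s).tsum_pos (fun k => mul_nonneg (gCoef_pos hν k).le (pow_nonneg hs k)) 0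
  simpa using gCoef_pos hν 0

lemma gFun_mono {ν : ℝ} (hν : -1 < ν) {s t : ℝ} (hs : 0 ≤ s) (hst : s ≤ t) :
    gFun ν s ≤ gFun ν t := by
  unfold gFun
  refine (gSummable hν s).tsum_le_tsum (fun k => ?_) (gSummable hν t)
  have := (gCoef_pos hν k).le
  gcongr

lemma gFun_hasDerivAt {ν : ℝ} (hν : -1 < ν) (s : ℝ) :
    HasDerivAt (gFun ν) (gFun (ν + 1) s) s := by
  have hν' : -1 < ν + 1 := by linarith
  have hsum0 : Summable fun k : ℕ => gCoef ν k * ((k : ℝ) * (|s| + 1) ^ (k - 1)) := by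
    rw [← summable_nat_add_iff 1]
    refine (gSummable hν' (|s| + 1)).congr fun k => ?_
    rw [← gCoef_succ']
    rw [Nat.add_sub_cancel]
    push_cast
    ring
  have h := hasDerivAt_tsum_of_isPreconnected (𝕜 := ℝ) (F := ℝ)
    (u := fun k : ℕ => gCoef ν k * ((k : ℝ) * (|s| + 1) ^ (k - 1)))
    (g := fun k x => gCoef ν k * x ^ k) (g' := fun k x => gCoef ν k * ((k : ℝ) * x ^ (k - 1)))
    (t := Metric.ball 0 (|s| + 1)) (y₀ := 0) (y := s) hsum0 Metric.isOpen_ball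
    (convex_ball _ _).isPreconnected
    (fun k x _ => (hasDerivAt_pow k x).const_mul _)
    (fun k x hx => by
      have hx' : |x| < |s| + 1 := by simpa using hx
      have := (gCoef_pos hν k).le
      rw [norm_mul, norm_mul, norm_pow, Real.norm_eq_abs, Real.norm_eq_abs, Real.norm_eq_abs,
        abs_of_nonneg this, Nat.abs_cast]
      gcongr)
    (by simp; positivity) (gSummable hν 0) (by simp)
  suffices hh : gFun (ν + 1) s = ∑' k : ℕ, gCoef ν k * ((k : ℝ) * s ^ (k - 1)) by
    rw [hh]; exact h
  unfold gFun
  have hsum1 : Summable fun k : ℕ => gCoef ν k * ((k : ℝ) * s ^ (k - 1)) := by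
    rw [← summable_nat_add_iff 1]
    refine (gSummable hν' s).congr fun k => ?_
    rw [← gCoef_succ']
    rw [Nat.add_sub_cancel]
    push_cast
    ring
  rw [hsum1.tsum_eq_zero_add]
  simp only [Nat.cast_zero, zero_mul, mul_zero, zero_add]
  refine tsum_congr fun k => ?_
  rw [← gCoef_succ']
  rw [Nat.add_sub_cancel]
  push_cast
  ring

lemma gFun_continuous {ν : ℝ} (hν : -1 < ν) : Continuous (gFun ν) :=
  continuous_iff_continuousAt.2 fun s => (gFun_hasDerivAt hν s).continuousAt

lemma gFun_hasSum1 {ν : ℝ} (hν : -1 < ν) (s : ℝ) :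
    HasSum (fun k : ℕ => (k : ℝ) * (gCoef ν k * s ^ k)) (s * gFun (ν + 1) s) := by
  have hν' : -1 < ν + 1 := by linarith
  rw [← hasSum_nat_add_iff' 1]
  simp only [Finset.range_one, Finset.sum_singleton, Nat.cast_zero, zero_mul, sub_zero]
  refine ((gSummable hν' s).hasSum.mul_left s).congr_fun ?_ |> id
  intro k
  rw [← gCoef_succ']
  push_cast
  ring

lemma gFun_hasSum2 {ν : ℝ} (hν : -1 < ν) (s : ℝ) :
    HasSum (fun k : ℕ => (k : ℝ) * ((k : ℝ) - 1) * (gCoef ν k * s ^ k)) (s ^ 2 * gFun (ν + 2) s) := by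
  have hν' : -1 < ν + 2 := by linarith
  rw [← hasSum_nat_add_iff' 2]
  simp only [Finset.sum_range_succ, Finset.range_one, Finset.sum_singleton, Nat.cast_zero, zero_mul, sub_zero, Nat.cast_one, sub_self, mul_zero, add_zero]
  refine ((gSummable hν' s).hasSum.mul_left (s ^ 2)).congr_fun ?_ |> id
  intro k
  rw [show ν + 2 = ν + 1 + 1 by ring, ← gCoef_succ', ← gCoef_succ']
  push_cast
  ring

lemma gFun_rec {ν : ℝ} (hν : -1 < ν) (s : ℝ) :
    gFun ν s = (ν + 1) * gFun (ν + 1) s + s * gFun (ν + 2) s := by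
  have hν' : -1 < ν + 1 := by linarith
  have h1 := (gFun_hasSum1 hν' s).add ((gSummable hν' s).hasSum.mul_left (ν + 1))
  rw [show ν + 1 + 1 = ν + 2 by ring] at h1
  have h2 := (gSummable hν s).hasSum
  have : (fun k : ℕ => gCoef ν k * s ^ k) = fun k : ℕ => (k:ℝ) * (gCoef (ν+1) k * s ^ k) + (ν + 1) * (gCoef (ν+1) k * s ^ k) := by
    funext k
    have hk : (0:ℝ) ≤ k := k.cast_nonneg
    have h3 : (k : ℝ) + ν + 1 ≠ 0 := by linarith
    have h4 : (k : ℝ) + 1 ≠ 0 := by linarith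
    rw [← gCoef_succ', gCoef_succ hν]
    field_simp
    ring
  rw [← this] at h1
  have h5 := h2.unique h1
  unfold gFun at *
  rw [h5, add_comm]

lemma gFun_jensen {ν : ℝ} (hν : -1 < ν) {s : ℝ} (hs : 0 < s) :
    ν * (gFun (ν + 1) s / gFun ν s) + s * (gFun (ν + 1) s / gFun ν s) ^ 2 ≤ 1 := by
  have hG := gFun_pos hν hs.le
  set m := s * gFun (ν + 1) s / gFun ν s with hm
  have h := ((gFun_hasSum2 hν s).add ((gFun_hasSum1 hν s).mul_left (1 - 2 * m))).add
    ((gSummable hν s).hasSum.mul_left (m ^ 2))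
  have h0 : 0 ≤ s ^ 2 * gFun (ν + 2) s + (1 - 2 * m) * (s * gFun (ν + 1) s) + m ^ 2 * gFun ν s := by
    refine h.nonneg fun k => ?_
    have : 0 ≤ gCoef ν k * s ^ k := mul_nonneg (gCoef_pos hν k).le (pow_nonneg hs.le k)
    have h2 := mul_nonneg (sq_nonneg ((k:ℝ) - m)) this
    nlinarith
  have hr := gFun_rec hν s
  set ρ := gFun (ν + 1) s / gFun ν s with hρ
  have h1 : gFun (ν + 1) s = ρ * gFun ν s := by rw [hρ]; field_simp
  have h2 : m = s * ρ := by rw [hm, hρ]; ring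
  rw [h1] at hr h0
  have h3 : s * gFun (ν + 2) s = gFun ν s - (ν + 1) * (ρ * gFun ν s) := by linarith
  have h4 : s ^ 2 * gFun (ν + 2) s = s * (gFun ν s - (ν + 1) * (ρ * gFun ν s)) := by rw [← h3]; ring
  rw [h4, h2] at h0
  have h5 : 0 ≤ (s * gFun ν s) * (1 - (ν * ρ + s * ρ ^ 2)) := by nlinarith
  have := nonneg_of_mul_nonneg_right h5 (by positivity)
  linarith

lemma gFun_upper {ν : ℝ} (hν : -1 < ν) {s : ℝ} (hs : 0 < s) :
    √s * (gFun (ν + 1) s / gFun ν s) ≤ 1 + 1 / √s := by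
  have hj := gFun_jensen hν hs
  have hq : 0 < √s := Real.sqrt_pos.2 hs
  have hρ : 0 < gFun (ν + 1) s / gFun ν s :=
    div_pos (gFun_pos (by linarith) hs.le) (gFun_pos hν hs.le)
  set ρ := gFun (ν + 1) s / gFun ν s
  set q := √s
  have hs2 : s = q ^ 2 := (Real.sq_sqrt hs.le).symm
  rw [hs2] at hj
  by_contra! hcon
  have h1 : ρ = (q * ρ) * (1 / q) := by field_simp
  have h2 : 0 < 1 / q := by positivity
  have h3 : 0 < q * ρ := by positivity
  set w := q * ρ
  set η := 1 / q
  have h4 : ν * (w * η) + w ^ 2 ≤ 1 := by rw [← h1]; nlinarith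
  have h5 : 0 < w * η := by positivity
  nlinarith

lemma gFun_upper' {ν : ℝ} (hν : 0 ≤ ν) {s : ℝ} (hs : 0 < s) :
    √s * (gFun (ν + 1) s / gFun ν s) ≤ 1 := by
  have hj := gFun_jensen (by linarith : -1 < ν) hs
  have hq : 0 < √s := Real.sqrt_pos.2 hs
  have hρ : 0 < gFun (ν + 1) s / gFun ν s :=
    div_pos (gFun_pos (by linarith) hs.le) (gFun_pos (by linarith) hs.le)
  set ρ := gFun (ν + 1) s / gFun ν s
  have hs2 : s = √s ^ 2 := (Real.sq_sqrt hs.le).symm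
  have h1 : 0 ≤ ν * ρ := by positivity
  have h2 : (√s * ρ) ^ 2 ≤ 1 := by rw [mul_pow, ← hs2]; linarith
  exact (sq_le_one_iff₀ (by positivity)).1 h2

lemma gFun_lower {ν : ℝ} (hν : -1 < ν) {s : ℝ} (hs : 0 < s) :
    1 / ((ν + 1) * (1 / √s) + 1) ≤ √s * (gFun (ν + 1) s / gFun ν s) := by
  have hu := gFun_upper' (by linarith : 0 ≤ ν + 1) hs
  rw [show ν + 1 + 1 = ν + 2 by ring] at hu
  have hq : 0 < √s := Real.sqrt_pos.2 hs
  have h0 := gFun_pos hν hs.le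
  have h1 := gFun_pos (by linarith : -1 < ν + 1) hs.le
  have h2 := gFun_pos (by linarith : -1 < ν + 2) hs.le
  have hr := gFun_rec hν s
  have hs2 : √s ^ 2 = s := Real.sq_sqrt hs.le
  set q := √s
  rw [← mul_div_assoc, div_le_one h1] at hu
  have hpos : 0 < (ν + 1) * (1 / q) + 1 := by
    have : 0 < ν + 1 := by linarith
    positivity
  rw [div_le_iff₀ hpos]
  have : q * (gFun (ν + 1) s / gFun ν s) * ((ν + 1) * (1 / q) + 1) =
      ((ν + 1) * gFun (ν + 1) s + q * gFun (ν + 1) s) / gFun ν s := by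
    field_simp
  rw [this, le_div_iff₀ h0, one_mul, hr]
  have h6 : s * gFun (ν + 2) s = q * (q * gFun (ν + 2) s) := by rw [← mul_assoc, ← sq, hs2]
  rw [h6]
  nlinarith

lemma gFun_ratio_tendsto {ν : ℝ} (hν : -1 < ν) :
    Tendsto (fun s => √s * (gFun (ν + 1) s / gFun ν s)) atTop (𝓝 1) := by
  have h : Tendsto (fun s : ℝ => 1 / √s) atTop (𝓝 0) := by
    simp only [one_div]
    exact tendsto_inv_atTop_zero.comp Real.tendsto_sqrt_atTop
  have h1 : Tendsto (fun s : ℝ => 1 / ((ν + 1) * (1 / √s) + 1)) atTop (𝓝 1) := by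
    have := ((h.const_mul (ν + 1)).add_const 1).inv₀ (by simp)
    simpa using this
  have h2 : Tendsto (fun s : ℝ => 1 + 1 / √s) atTop (𝓝 1) := by
    simpa using h.const_add 1
  refine tendsto_of_tendsto_of_tendsto_of_le_of_le' h1 h2 ?_ ?_
  · filter_upwards [eventually_gt_atTop 0] with s hs using gFun_lower hν hs
  · filter_upwards [eventually_gt_atTop 0] with s hs using gFun_upper hν hs

/-- The key ratio asymptotics. -/
lemma gFun_shift_tendsto {ν c r x : ℝ} (hν : -1 < ν) (hc0 : 0 < c) (hr : 0 < r) (hx : 0 < x) :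
    Tendsto (fun z : ℝ => gFun ν (z * r * (z - c * x) / 4) / gFun ν (z * r * z / 4)) atTop
      (𝓝 (Real.exp (-(c * √r / 2 * x)))) := by
  have hmvt : ∀ z : ℝ, c * x < z → ∃ y ∈ Ioo (z - c * x) z,
      Real.log (gFun ν (z * r * z / 4)) - Real.log (gFun ν (z * r * (z - c * x) / 4)) =
      (gFun (ν + 1) (z * r * y / 4) / gFun ν (z * r * y / 4)) * (z * r / 4) * (c * x) := by
    intro z hz
    have hcx : 0 < c * x := by positivity
    have hd : ∀ y ∈ Icc (z - c * x) z, HasDerivAt (fun y => Real.log (gFun ν (z * r * y / 4)))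
        ((gFun (ν + 1) (z * r * y / 4) / gFun ν (z * r * y / 4)) * (z * r / 4)) y := by
      intro y hy
      have hy0 : 0 < y := by linarith [hy.1]
      have hz0 : 0 < z := by linarith
      have e : HasDerivAt (fun y : ℝ => z * r * y / 4) (z * r / 4) y := by
        simpa using ((hasDerivAt_id y).const_mul (z * r)).div_const 4
      have hp : gFun ν (z * r * y / 4) ≠ 0 := (gFun_pos hν (by positivity)).ne'
      have h1 : HasDerivAt (fun y => gFun ν (z * r * y / 4))
          (gFun (ν + 1) (z * r * y / 4) * (z * r / 4)) y :=
        HasDerivAt.comp (h₂ := gFun ν) y (gFun_hasDerivAt hν (z * r * y / 4)) e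
      have h2 := h1.log hp
      rwa [mul_div_right_comm] at h2
    obtain ⟨y, hy, h⟩ := exists_hasDerivAt_eq_slope _ _ (by linarith : z - c * x < z)
      (fun y hy => (hd y hy).continuousAt.continuousWithinAt) (fun y hy => hd y ⟨hy.1.le, hy.2.le⟩)
    refine ⟨y, hy, ?_⟩
    rw [h]
    rw [show z - (z - c * x) = c * x by ring]
    field_simp
  choose! y hy hlog using hmvt
  have hev : ∀ᶠ z in atTop, c * x < z := eventually_gt_atTop _
  have hev0 : ∀ᶠ z in atTop, (0:ℝ) < z := eventually_gt_atTop _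
  -- y z / z → 1
  have hy1 : Tendsto (fun z => y z / z) atTop (𝓝 1) := by
    have h1 : Tendsto (fun z : ℝ => 1 - c * x * z⁻¹) atTop (𝓝 1) := by
      simpa using (tendsto_inv_atTop_zero.const_mul (c * x)).const_sub 1
    refine tendsto_of_tendsto_of_tendsto_of_le_of_le' h1 tendsto_const_nhds ?_ ?_
    · filter_upwards [hev, hev0] with z hz hz0
      rw [le_div_iff₀ hz0]
      have := (hy z hz).1
      field_simp
      linarith
    · filter_upwards [hev, hev0] with z hz hz0
      rw [div_le_one hz0]
      exact (hy z hz).2.le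
  have hyt : Tendsto (fun z => z * r * y z / 4) atTop atTop := by
    have h1 : Tendsto (fun z => (z * z) * ((r / 4) * (y z / z))) atTop atTop := by
      refine (tendsto_id.atTop_mul_atTop₀ tendsto_id).atTop_mul_pos (C := r / 4 * 1) (by positivity) (hy1.const_mul _)
    refine h1.congr' ?_
    filter_upwards [hev0] with z hz0
    field_simp
  have hw := (gFun_ratio_tendsto hν).comp hyt
  have hL : Tendsto (fun z => (√(z * r * y z / 4) * (gFun (ν + 1) (z * r * y z / 4) / gFun ν (z * r * y z / 4)))
      * ((√(r * (y z / z)))⁻¹ * (r * c * x / 2))) atTop (𝓝 (1 * ((√(r * 1))⁻¹ * (r * c * x / 2)))) := by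
    refine Tendsto.mul hw (Tendsto.mul_const _ (Tendsto.inv₀ ?_ ?_))
    · exact (Real.continuous_sqrt.tendsto _).comp (hy1.const_mul r)
    · simp; positivity
  have hval : 1 * ((√(r * 1))⁻¹ * (r * c * x / 2)) = c * √r / 2 * x := by
    have h1 : √r ≠ 0 := (Real.sqrt_pos.2 hr).ne'
    rw [mul_one, one_mul]
    nth_rewrite 2 [← Real.mul_self_sqrt hr.le]
    field_simp
  rw [hval] at hL
  have hfin := (Real.continuous_exp.tendsto _).comp hL.neg
  refine hfin.congr' ?_
  filter_upwards [hev, hev0] with z hz hz0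
  have hyz := hy z hz
  have hcx : 0 < c * x := by positivity
  have hy0 : 0 < y z := by linarith [hyz.1]
  have hzc : 0 < z - c * x := by linarith
  have e1 := gFun_pos hν (by positivity : 0 ≤ z * r * z / 4)
  have e2 := gFun_pos hν (by positivity : 0 ≤ z * r * (z - c * x) / 4)
  rw [← Real.exp_log (div_pos e2 e1), Real.log_div e2.ne' e1.ne']
  simp only [Function.comp]
  congr 1
  rw [← neg_sub, hlog z hz]
  congr 1
  have hsq : √(z * r * y z / 4) = z / 2 * √(r * (y z / z)) := by
    rw [show z * r * y z / 4 = (z / 2) ^ 2 * (r * (y z / z)) by field_simp; ring,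
      Real.sqrt_mul (by positivity), Real.sqrt_sq (by positivity)]
  rw [hsq]
  have : √(r * (y z / z)) ≠ 0 := (Real.sqrt_pos.2 (by positivity)).ne'
  field_simp
  norm_num

/-! ### The transition density through `gFun` -/

noncomputable def kern (δ t x y : ℝ) : ℝ :=
  (2 * t) ^ (-(δ / 2)) * y ^ (δ / 2 - 1) * Real.exp (-(x + y) / (2 * t)) *
    gFun (δ / 2 - 1) (x * y / (4 * t ^ 2))

lemma besselI_eq {ν w : ℝ} (hw : 0 < w) :
    besselI ν w = (w / 2) ^ ν * gFun ν ((w / 2) ^ 2) := by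
  unfold besselI gFun
  rw [← tsum_mul_left]
  refine tsum_congr fun k => ?_
  have h : 0 < w / 2 := by positivity
  rw [Real.rpow_add h, Real.rpow_mul h.le, Real.rpow_natCast, Real.rpow_two]
  unfold gCoef
  ring

lemma sqBesselP_eq {δ t x y : ℝ} (ht : 0 < t) (hx : 0 < x) (hy : 0 < y) :
    sqBesselP δ t x y = kern δ t x y := by
  unfold sqBesselP kern
  have hs : 0 < √(x * y) := Real.sqrt_pos.2 (by positivity)
  rw [besselI_eq (by positivity)]
  have e1 : (√(x * y) / t / 2) ^ 2 = x * y / (4 * t ^ 2) := by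
    rw [div_pow, div_pow, Real.sq_sqrt (by positivity)]; field_simp; norm_num
  rw [e1, show (δ - 2) / 2 = δ / 2 - 1 by ring]
  have e2 : (y / x) ^ ((δ - 2) / 4) = √(y / x) ^ (δ / 2 - 1) := by
    rw [Real.sqrt_eq_rpow, ← Real.rpow_mul (by positivity)]; congr 1; ring
  have e3 : √(y / x) ^ (δ / 2 - 1) * (√(x * y) / t / 2) ^ (δ / 2 - 1) = (y / (2 * t)) ^ (δ / 2 - 1) := by
    rw [← Real.mul_rpow (by positivity) (by positivity)]
    congr 1
    have : √(y / x) * √(x * y) = y := by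
      rw [← Real.sqrt_mul (by positivity), show y / x * (x * y) = y ^ 2 by field_simp,
        Real.sqrt_sq hy.le]
    rw [← mul_div_assoc, ← mul_div_assoc, this, div_div, mul_comm t]
  have e4 : (2 * t)⁻¹ * (y / (2 * t)) ^ (δ / 2 - 1) = (2 * t) ^ (-(δ / 2)) * y ^ (δ / 2 - 1) := by
    rw [Real.div_rpow hy.le (by positivity), show -(δ / 2) = -1 - (δ / 2 - 1) by ring,
      Real.rpow_sub (by positivity : 0 < 2 * t) (-1) (δ / 2 - 1), Real.rpow_neg_one]
    ring
  rw [e2, ← e4, ← e3]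
  ring

lemma sqBesselP0_mul {c δ₁ δ₂ ε z x : ℝ} (hε : 0 < ε) :
    sqBesselP0 δ₁ ε x * sqBesselP0 δ₂ ε (z - c * x) =
      (Real.exp (-(z / (2 * ε))) / (((2 * ε) ^ (δ₁ / 2) * Real.Gamma (δ₁ / 2)) *
        ((2 * ε) ^ (δ₂ / 2) * Real.Gamma (δ₂ / 2)))) *
      (x ^ (δ₁ / 2 - 1) * Real.exp (-((1 - c) / 2 * x / ε)) * (z - c * x) ^ (δ₂ / 2 - 1)) := by
  unfold sqBesselP0
  have : Real.exp (-x / (2 * ε)) * Real.exp (-(z - c * x) / (2 * ε)) =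
      Real.exp (-(z / (2 * ε))) * Real.exp (-((1 - c) / 2 * x / ε)) := by
    rw [← Real.exp_add, ← Real.exp_add]; congr 1; field_simp; ring
  linear_combination (x ^ (δ₁ / 2 - 1) / ((2 * ε) ^ (δ₁ / 2) * Real.Gamma (δ₁ / 2))) *
    ((z - c * x) ^ (δ₂ / 2 - 1) / ((2 * ε) ^ (δ₂ / 2) * Real.Gamma (δ₂ / 2))) * this

/-! ### Integral lemmas -/

lemma continuousOn_param {X : Type*} [TopologicalSpace X] [FirstCountableTopology X] {K : Set X}
    (hK : IsCompact K) {z : ℝ} {w : ℝ → ℝ} (hw : IntegrableOn w (Ioo 0 z)) {Ψ : X → ℝ → ℝ}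
    (hΨ : ContinuousOn (Function.uncurry Ψ) (K ×ˢ Icc 0 z)) :
    ContinuousOn (fun p => ∫ x in Ioo 0 z, w x * Ψ p x) K := by
  obtain ⟨M, hM⟩ := (hK.prod isCompact_Icc).exists_bound_of_continuousOn hΨ
  apply continuousOn_of_dominated (bound := fun x => ‖w x‖ * M)
  · intro p hp
    refine hw.aestronglyMeasurable.mul ?_
    refine ContinuousOn.aestronglyMeasurable ?_ measurableSet_Ioo
    exact hΨ.comp (f := fun x => (p, x)) (by fun_prop) fun x hx => ⟨hp, Ioo_subset_Icc_self hx⟩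
  · intro p hp
    filter_upwards [ae_restrict_mem measurableSet_Ioo] with x hx
    rw [norm_mul]
    exact mul_le_mul_of_nonneg_left (hM (p, x) ⟨hp, Ioo_subset_Icc_self hx⟩) (norm_nonneg _)
  · exact hw.norm.mul_const M
  · filter_upwards [ae_restrict_mem measurableSet_Ioo] with x hx
    refine continuousOn_const.mul ?_
    exact hΨ.comp (f := fun p => (p, x)) (by fun_prop) fun p hp => ⟨hp, Ioo_subset_Icc_self hx⟩

lemma integrableOn_rpow_Ioo {a z : ℝ} (ha : 0 < a) (hz : 0 < z) :
    IntegrableOn (fun x : ℝ => x ^ (a - 1)) (Ioo 0 z) := by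
  have h := intervalIntegral.intervalIntegrable_rpow' (a := 0) (b := z) (by linarith : -1 < a - 1)
  rw [intervalIntegrable_iff_integrableOn_Ioc_of_le hz.le] at h
  exact h.mono_set Ioo_subset_Ioc_self

lemma integrableOn_rpow_exp {a k : ℝ} (ha : 0 < a) (hk : 0 < k) :
    IntegrableOn (fun u : ℝ => u ^ (a - 1) * Real.exp (-(k * u))) (Ioi 0) := by
  by_contra h
  have h1 := Real.integral_rpow_mul_exp_neg_mul_Ioi ha hk
  rw [integral_undef h] at h1
  have := Real.Gamma_pos_of_pos ha
  have h2 : 0 < (1 / k) ^ a * Real.Gamma a := by positivity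
  linarith

lemma integral_scale {e m : ℝ} (he : 0 < e) (hm : 0 ≤ m) (f : ℝ → ℝ) :
    ∫ x in Ioo 0 (e * m), f x = e * ∫ u in Ioo 0 m, f (e * u) := by
  rw [← integral_Ioc_eq_integral_Ioo, ← integral_Ioc_eq_integral_Ioo,
    ← intervalIntegral.integral_of_le hm, ← intervalIntegral.integral_of_le (by positivity),
    intervalIntegral.integral_comp_mul_left f he.ne', smul_eq_mul, mul_zero]
  field_simp

lemma integral_pos_weight {a z : ℝ} (ha : 0 < a) (hz : 0 < z) {Ψ : ℝ → ℝ}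
    (hΨ : ContinuousOn Ψ (Icc 0 z)) (hpos : ∀ x ∈ Ioo 0 z, 0 < Ψ x) :
    0 < ∫ x in Ioo 0 z, x ^ (a - 1) * Ψ x := by
  obtain ⟨M, hM⟩ := isCompact_Icc.exists_bound_of_continuousOn hΨ
  have hp : ∀ x ∈ Ioo 0 z, 0 < x ^ (a - 1) * Ψ x := fun x hx =>
    mul_pos (Real.rpow_pos_of_pos hx.1 _) (hpos x hx)
  rw [setIntegral_pos_iff_support_of_nonneg_ae]
  · refine lt_of_lt_of_le ?_ (measure_mono (fun x (hx : x ∈ Ioo 0 z) => ⟨(hp x hx).ne', hx⟩))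
    simp [hz]
  · filter_upwards [ae_restrict_mem measurableSet_Ioo] with x hx using (hp x hx).le
  · refine (integrableOn_rpow_Ioo ha hz).mul_bdd (c := M) ?_ ?_
    · exact (hΨ.mono Ioo_subset_Icc_self).aestronglyMeasurable measurableSet_Ioo
    · filter_upwards [ae_restrict_mem measurableSet_Ioo] with x hx
      exact hM x (Ioo_subset_Icc_self hx)

lemma approx_identity {a k z : ℝ} (ha : 0 < a) (hk : 0 < k) (hz : 0 < z) {F : ℝ → ℝ → ℝ}
    (hF : ContinuousOn (Function.uncurry F) (Icc 0 (1 / 2) ×ˢ Icc 0 z)) :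
    Tendsto (fun ε => ε ^ (-a) * ∫ x in Ioo 0 z, x ^ (a - 1) * Real.exp (-(k * x / ε)) * F ε x)
      (𝓝[>] 0) (𝓝 (((1 / k) ^ a * Real.Gamma a) * F 0 0)) := by
  obtain ⟨M, hM⟩ := (isCompact_Icc.prod isCompact_Icc).exists_bound_of_continuousOn hF
  have hev : ∀ᶠ ε : ℝ in 𝓝[>] 0, ε ∈ Ioo (0:ℝ) (1 / 2) := Ioo_mem_nhdsGT (by norm_num)
  have key : Tendsto (fun ε : ℝ => ∫ u in Ioi (0:ℝ),
      (Ioo 0 (z / ε)).indicator (fun u => u ^ (a - 1) * Real.exp (-(k * u)) * F ε (ε * u)) u) (𝓝[>] 0)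
      (𝓝 (∫ u in Ioi (0:ℝ), u ^ (a - 1) * Real.exp (-(k * u)) * F 0 0)) := by
    apply tendsto_integral_filter_of_dominated_convergence
      (fun u => u ^ (a - 1) * Real.exp (-(k * u)) * M)
    · filter_upwards [hev] with ε hε
      have hε0 := hε.1
      rw [aestronglyMeasurable_indicator_iff measurableSet_Ioo, Measure.restrict_restrict measurableSet_Ioo]
      refine AEStronglyMeasurable.mono_measure ?_ (Measure.restrict_mono inter_subset_left le_rfl)
      refine ContinuousOn.aestronglyMeasurable ?_ measurableSet_Ioo
      refine ContinuousOn.mul (ContinuousOn.mul ?_ (by fun_prop)) ?_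
      · exact fun u hu => (Real.continuousAt_rpow_const _ _ (Or.inl hu.1.ne')).continuousWithinAt
      · refine hF.comp (f := fun u => (ε, ε * u)) (by fun_prop) fun u hu => ?_
        refine ⟨⟨hε.1.le, hε.2.le⟩, ⟨?_, ?_⟩⟩
        · exact (mul_pos hε0 hu.1).le
        · have := hu.2.le
          rw [le_div_iff₀ hε0] at this
          simpa [mul_comm] using this
    · filter_upwards [hev] with ε hε
      have hε0 := hε.1
      filter_upwards [ae_restrict_mem measurableSet_Ioi] with u hu
      have hu0 : 0 < u := hu
      have hM0 : 0 ≤ M := le_trans (norm_nonneg _) (hM (0, 0) ⟨⟨le_rfl, by norm_num⟩, ⟨le_rfl, hz.le⟩⟩)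
      have hw : 0 ≤ u ^ (a - 1) * Real.exp (-(k * u)) := by positivity
      by_cases h : u ∈ Ioo 0 (z / ε)
      · rw [indicator_of_mem h, norm_mul, Real.norm_of_nonneg hw]
        refine mul_le_mul_of_nonneg_left (hM (ε, ε * u) ⟨⟨hε.1.le, hε.2.le⟩, ⟨?_, ?_⟩⟩) hw
        · exact (mul_pos hε0 hu0).le
        · have := h.2.le
          rw [le_div_iff₀ hε0] at this
          simpa [mul_comm] using this
      · rw [indicator_of_notMem h, norm_zero]
        positivity
    · exact (integrableOn_rpow_exp ha hk).mul_const M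
    · filter_upwards [ae_restrict_mem measurableSet_Ioi] with u hu
      have hu0 : 0 < u := hu
      have hev2 : ∀ᶠ ε : ℝ in 𝓝[>] 0, ε ∈ Ioo (0:ℝ) (z / u) := Ioo_mem_nhdsGT (by positivity)
      have hT : Tendsto (fun ε : ℝ => (ε, ε * u)) (𝓝[>] 0) (𝓝[Icc 0 (1 / 2) ×ˢ Icc 0 z] ((0:ℝ), (0:ℝ))) := by
        rw [tendsto_nhdsWithin_iff]
        constructor
        · have : Continuous fun ε : ℝ => (ε, ε * u) := by fun_prop
          have h := this.tendsto 0
          simp only [zero_mul] at h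
          exact h.mono_left nhdsWithin_le_nhds
        · filter_upwards [hev, hev2] with ε h1 h2
          refine ⟨⟨h1.1.le, h1.2.le⟩, ⟨(mul_pos h1.1 hu0).le, ?_⟩⟩
          have := h2.2.le
          rwa [le_div_iff₀ hu0] at this
      have h00 : ((0:ℝ), (0:ℝ)) ∈ Icc (0:ℝ) (1 / 2) ×ˢ Icc (0:ℝ) z :=
        ⟨⟨le_rfl, by norm_num⟩, ⟨le_rfl, hz.le⟩⟩
      have hF0 : Tendsto (fun ε => F ε (ε * u)) (𝓝[>] 0) (𝓝 (F 0 0)) :=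
        Tendsto.comp (hF _ h00) hT
      refine (hF0.const_mul _).congr' ?_
      filter_upwards [hev, hev2] with ε h1 h2
      rw [indicator_of_mem]
      refine ⟨hu0, ?_⟩
      rw [lt_div_iff₀ h1.1]
      have := h2.2
      rwa [lt_div_iff₀ hu0, mul_comm] at this
  rw [integral_mul_const, Real.integral_rpow_mul_exp_neg_mul_Ioi ha hk] at key
  refine key.congr' ?_
  filter_upwards [hev] with ε hε
  have hε0 := hε.1
  rw [setIntegral_indicator measurableSet_Ioo, inter_eq_right.2 Ioo_subset_Ioi_self]
  have hze : z = ε * (z / ε) := by field_simp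
  conv_rhs => rw [hze, integral_scale hε0 (by positivity)]
  rw [← mul_assoc, ← integral_const_mul]
  refine setIntegral_congr_fun measurableSet_Ioo fun u hu => ?_
  have hu0 : 0 < u := hu.1
  beta_reduce
  rw [Real.mul_rpow hε0.le hu0.le, show k * (ε * u) / ε = k * u by field_simp]
  have : ε ^ (-a) * ε * ε ^ (a - 1) = 1 := by
    nth_rewrite 2 [← Real.rpow_one ε]
    rw [← Real.rpow_add hε0, ← Real.rpow_add hε0]
    simp
  linear_combination (-(u ^ (a - 1) * Real.exp (-(k * u)) * F ε (ε * u))) * this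

lemma laplace_limit {ν a c r κ : ℝ} (hν : -1 < ν) (ha : 0 < a) (hc0 : 0 < c) (hc1 : c < 1)
    (hr : 0 < r) (hκ : 0 < κ) :
    Tendsto (fun z : ℝ => ∫ x in Ioo 0 z, x ^ (a - 1) * Real.exp (-(κ * x)) *
      ((1 - c * x / z) ^ ν * (gFun ν (z * r * (z - c * x) / 4) / gFun ν (z * r * z / 4)))) atTop
      (𝓝 ((1 / (κ + c * √r / 2)) ^ a * Real.Gamma a)) := by
  have hsr : 0 < √r := Real.sqrt_pos.2 hr
  set M := max 1 ((1 - c) ^ ν) with hM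
  have hM0 : 0 < M := lt_of_lt_of_le one_pos (le_max_left _ _)
  have key : Tendsto (fun z : ℝ => ∫ x in Ioi (0:ℝ), (Ioo 0 z).indicator (fun x =>
      x ^ (a - 1) * Real.exp (-(κ * x)) *
      ((1 - c * x / z) ^ ν * (gFun ν (z * r * (z - c * x) / 4) / gFun ν (z * r * z / 4)))) x) atTop
      (𝓝 (∫ x in Ioi (0:ℝ), x ^ (a - 1) * Real.exp (-((κ + c * √r / 2) * x)))) := by
    have hbase : ∀ z x : ℝ, 0 < z → x ∈ Ioo 0 z → 1 - c < 1 - c * x / z ∧ 1 - c * x / z < 1 ∧ 0 < z - c * x := by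
      intro z x hz hx
      have h1 : c * x / z < c := by
        rw [div_lt_iff₀ hz]; exact mul_lt_mul_of_pos_left hx.2 hc0
      have h2 : 0 < c * x / z := div_pos (mul_pos hc0 hx.1) hz
      refine ⟨by linarith, by linarith, ?_⟩
      nlinarith [hx.1, hx.2]
    apply tendsto_integral_filter_of_dominated_convergence
      (fun x => x ^ (a - 1) * Real.exp (-(κ * x)) * M)
    · filter_upwards [eventually_gt_atTop 0] with z hz
      rw [aestronglyMeasurable_indicator_iff measurableSet_Ioo, Measure.restrict_restrict measurableSet_Ioo]
      refine AEStronglyMeasurable.mono_measure ?_ (Measure.restrict_mono inter_subset_left le_rfl)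
      refine ContinuousOn.aestronglyMeasurable ?_ measurableSet_Ioo
      refine ContinuousOn.mul (ContinuousOn.mul ?_ (by fun_prop)) (ContinuousOn.mul ?_ ?_)
      · exact fun u hu => (Real.continuousAt_rpow_const _ _ (Or.inl hu.1.ne')).continuousWithinAt
      · refine ContinuousOn.rpow_const (by fun_prop) fun x hx => Or.inl ?_
        have := (hbase z x hz hx).1
        linarith
      · refine ContinuousOn.div_const ?_ _
        exact ((gFun_continuous hν).comp (by fun_prop)).continuousOn
    · filter_upwards [eventually_gt_atTop 0] with z hz
      filter_upwards [ae_restrict_mem measurableSet_Ioi] with x hx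
      have hx0 : 0 < x := hx
      have hw : 0 ≤ x ^ (a - 1) * Real.exp (-(κ * x)) := by positivity
      by_cases h : x ∈ Ioo 0 z
      · obtain ⟨h1, h2, h3⟩ := hbase z x hz h
        have hp : 0 < 1 - c * x / z := by linarith
        have hpow : (1 - c * x / z) ^ ν ≤ M := by
          rcases le_or_gt 0 ν with h0 | h0
          · exact (Real.rpow_le_one hp.le h2.le h0).trans (le_max_left _ _)
          · exact (Real.rpow_le_rpow_of_nonpos (by linarith) h1.le h0.le).trans (le_max_right _ _)
        have g1 : 0 < gFun ν (z * r * z / 4) := gFun_pos hν (by positivity)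
        have g2 : 0 < gFun ν (z * r * (z - c * x) / 4) := gFun_pos hν (by positivity)
        have g3 : gFun ν (z * r * (z - c * x) / 4) / gFun ν (z * r * z / 4) ≤ 1 := by
          rw [div_le_one g1]
          apply gFun_mono hν (by positivity)
          have : z - c * x ≤ z := by nlinarith
          gcongr
        have hp2 : 0 ≤ (1 - c * x / z) ^ ν := by positivity
        have g4 : 0 ≤ gFun ν (z * r * (z - c * x) / 4) / gFun ν (z * r * z / 4) := by positivity
        rw [indicator_of_mem h, Real.norm_of_nonneg (by positivity)]
        refine mul_le_mul_of_nonneg_left ?_ hw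
        calc _ ≤ M * 1 := mul_le_mul hpow g3 g4 hM0.le
          _ = M := mul_one M
      · rw [indicator_of_notMem h, norm_zero]
        positivity
    · exact (integrableOn_rpow_exp ha hκ).mul_const M
    · filter_upwards [ae_restrict_mem measurableSet_Ioi] with x hx
      have hx0 : 0 < x := hx
      have t1 : Tendsto (fun z : ℝ => (1 - c * x / z) ^ ν) atTop (𝓝 1) := by
        have : Tendsto (fun z : ℝ => 1 - c * x / z) atTop (𝓝 1) := by
          simpa [div_eq_mul_inv] using (tendsto_inv_atTop_zero.const_mul (c * x)).const_sub 1
        simpa using this.rpow_const (p := ν) (Or.inl one_ne_zero)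
      have t2 := gFun_shift_tendsto hν hc0 hr hx0
      have t3 := (t1.mul t2).const_mul (x ^ (a - 1) * Real.exp (-(κ * x)))
      have e : x ^ (a - 1) * Real.exp (-(κ * x)) * (1 * Real.exp (-(c * √r / 2 * x))) =
          x ^ (a - 1) * Real.exp (-((κ + c * √r / 2) * x)) := by
        rw [one_mul, mul_assoc, ← Real.exp_add]
        congr 2
        ring
      rw [e] at t3
      refine t3.congr' ?_
      filter_upwards [eventually_gt_atTop x] with z hz
      rw [indicator_of_mem]
      exact ⟨hx0, hz⟩
  rw [Real.integral_rpow_mul_exp_neg_mul_Ioi ha (by positivity)] at key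
  refine key.congr fun z => ?_
  rw [setIntegral_indicator measurableSet_Ioo, inter_eq_right.2 Ioo_subset_Ioi_self]

/-! ### Continuity of the kernels -/

lemma kern_pos {δ t x y : ℝ} (hδ : 0 < δ) (ht : 0 < t) (hx : 0 ≤ x) (hy : 0 < y) :
    0 < kern δ t x y := by
  unfold kern
  have := gFun_pos (by linarith : -1 < δ / 2 - 1) (by positivity : 0 ≤ x * y / (4 * t ^ 2))
  positivity

lemma sub_mul_pos {c z x : ℝ} (hc0 : 0 < c) (hc1 : c < 1) (hz : 0 < z) (hx : x ∈ Icc 0 z) :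
    0 < z - c * x := by
  have h1 : c * x ≤ c * z := mul_le_mul_of_nonneg_left hx.2 hc0.le
  nlinarith

noncomputable def psiE (c δ₁ δ₂ z₁ z₂ : ℝ) (p : ℝ × ℝ) (x : ℝ) : ℝ :=
  (z₁ - c * p.2) ^ (δ₂ / 2 - 1) * ((2 * (1 - p.1)) ^ (-(δ₁ / 2)) *
    Real.exp (-(p.2 + x) / (2 * (1 - p.1))) * gFun (δ₁ / 2 - 1) (p.2 * x / (4 * (1 - p.1) ^ 2)) *
    kern δ₂ (1 - p.1) (z₁ - c * p.2) (z₂ - c * x))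

lemma psiE_continuousOn {c δ₁ δ₂ z₁ z₂ : ℝ} (hc0 : 0 < c) (hc1 : c < 1) (hδ₁ : 0 < δ₁)
    (hδ₂ : 0 < δ₂) (hz₁ : 0 < z₁) (hz₂ : 0 < z₂) :
    ContinuousOn (Function.uncurry (psiE c δ₁ δ₂ z₁ z₂))
      ((Icc (0:ℝ) (1 / 2) ×ˢ Icc 0 z₁) ×ˢ Icc 0 z₂) := by
  have hg1 := gFun_continuous (by linarith : -1 < δ₁ / 2 - 1)
  have hg2 := gFun_continuous (by linarith : -1 < δ₂ / 2 - 1)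
  have ht : ∀ q ∈ (Icc (0:ℝ) (1 / 2) ×ˢ Icc 0 z₁) ×ˢ Icc 0 z₂, (1 - q.1.1) ≠ 0 := by
    intro q hq
    have := hq.1.1.2
    linarith
  have h1 : ∀ q ∈ (Icc (0:ℝ) (1 / 2) ×ˢ Icc 0 z₁) ×ˢ Icc 0 z₂, z₁ - c * q.1.2 ≠ 0 := fun q hq =>
    (sub_mul_pos hc0 hc1 hz₁ hq.1.2).ne'
  have h2 : ∀ q ∈ (Icc (0:ℝ) (1 / 2) ×ˢ Icc 0 z₁) ×ˢ Icc 0 z₂, z₂ - c * q.2 ≠ 0 := fun q hq =>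
    (sub_mul_pos hc0 hc1 hz₂ hq.2).ne'
  unfold Function.uncurry psiE kern
  refine ContinuousOn.mul ?_ (ContinuousOn.mul (ContinuousOn.mul (ContinuousOn.mul ?_ ?_) ?_)
    (ContinuousOn.mul (ContinuousOn.mul (ContinuousOn.mul ?_ ?_) ?_) ?_))
  · exact ContinuousOn.rpow_const (by fun_prop) fun q hq => Or.inl (h1 q hq)
  · exact ContinuousOn.rpow_const (by fun_prop) fun q hq => Or.inl (mul_ne_zero two_ne_zero (ht q hq))
  · exact ContinuousOn.rexp (ContinuousOn.div (by fun_prop) (by fun_prop)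
      fun q hq => mul_ne_zero two_ne_zero (ht q hq))
  · exact hg1.comp_continuousOn (ContinuousOn.div (by fun_prop) (by fun_prop)
      fun q hq => mul_ne_zero four_ne_zero (pow_ne_zero 2 (ht q hq)))
  · exact ContinuousOn.rpow_const (by fun_prop) fun q hq => Or.inl (mul_ne_zero two_ne_zero (ht q hq))
  · exact ContinuousOn.rpow_const (by fun_prop) fun q hq => Or.inl (h2 q hq)
  · exact ContinuousOn.rexp (ContinuousOn.div (by fun_prop) (by fun_prop)
      fun q hq => mul_ne_zero two_ne_zero (ht q hq))
  · exact hg2.comp_continuousOn (ContinuousOn.div (by fun_prop) (by fun_prop)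
      fun q hq => mul_ne_zero four_ne_zero (pow_ne_zero 2 (ht q hq)))

lemma eps_eq {c δ₁ δ₂ z₁ z₂ ε : ℝ} (hc0 : 0 < c) (hc1 : c < 1)
    (hz₁ : 0 < z₁) (hz₂ : 0 < z₂) (hε : 0 < ε) (hε1 : ε < 1) (H : ℝ → ℝ) :
    ∫ x₁ in Ioo (0 : ℝ) z₁, ∫ x₂ in Ioo (0 : ℝ) z₂,
      sqBesselP0 δ₁ ε x₁ * sqBesselP0 δ₂ ε (z₁ - c * x₁) *
      sqBesselP δ₁ (1 - ε) x₁ x₂ * sqBesselP δ₂ (1 - ε) (z₁ - c * x₁) (z₂ - c * x₂) * H x₂ =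
    (Real.exp (-(z₁ / (2 * ε))) / (((2 * ε) ^ (δ₁ / 2) * Real.Gamma (δ₁ / 2)) *
        ((2 * ε) ^ (δ₂ / 2) * Real.Gamma (δ₂ / 2)))) *
      ∫ x₁ in Ioo (0 : ℝ) z₁, x₁ ^ (δ₁ / 2 - 1) * Real.exp (-((1 - c) / 2 * x₁ / ε)) *
        ∫ x₂ in Ioo (0 : ℝ) z₂, x₂ ^ (δ₁ / 2 - 1) * (psiE c δ₁ δ₂ z₁ z₂ (ε, x₁) x₂ * H x₂) := by
  rw [← integral_const_mul]
  refine setIntegral_congr_fun measurableSet_Ioo fun x₁ hx₁ => ?_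
  beta_reduce
  rw [← mul_assoc, ← integral_const_mul]
  refine setIntegral_congr_fun measurableSet_Ioo fun x₂ hx₂ => ?_
  beta_reduce
  have e1 := sub_mul_pos hc0 hc1 hz₁ (Ioo_subset_Icc_self hx₁)
  have e2 := sub_mul_pos hc0 hc1 hz₂ (Ioo_subset_Icc_self hx₂)
  rw [sqBesselP0_mul hε, sqBesselP_eq (by linarith) hx₁.1 hx₂.1, sqBesselP_eq (by linarith) e1 e2]
  unfold psiE
  rw [show kern δ₁ (1 - ε) x₁ x₂ = (2 * (1 - ε)) ^ (-(δ₁ / 2)) * x₂ ^ (δ₁ / 2 - 1) *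
    Real.exp (-(x₁ + x₂) / (2 * (1 - ε))) * gFun (δ₁ / 2 - 1) (x₁ * x₂ / (4 * (1 - ε) ^ 2)) from rfl]
  ring

noncomputable def jInt (c δ₁ δ₂ z₁ z₂ : ℝ) (H : ℝ → ℝ) : ℝ :=
  ∫ x in Ioo (0 : ℝ) z₂, x ^ (δ₁ / 2 - 1) * (Real.exp (-x / 2) * kern δ₂ 1 z₁ (z₂ - c * x) * H x)

lemma jker_continuousOn {c δ₂ z₁ z₂ : ℝ} (hc0 : 0 < c) (hc1 : c < 1)
    (hδ₂ : 0 < δ₂) (hz₂ : 0 < z₂) :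
    ContinuousOn (fun x => Real.exp (-x / 2) * kern δ₂ 1 z₁ (z₂ - c * x)) (Icc 0 z₂) := by
  have hg2 := gFun_continuous (by linarith : -1 < δ₂ / 2 - 1)
  unfold kern
  refine ContinuousOn.mul (by fun_prop)
    (ContinuousOn.mul (ContinuousOn.mul (ContinuousOn.mul (by fun_prop) ?_) (by fun_prop)) ?_)
  · exact ContinuousOn.rpow_const (by fun_prop)
      fun x hx => Or.inl (sub_mul_pos hc0 hc1 hz₂ hx).ne'
  · exact hg2.comp_continuousOn (by fun_prop)

lemma jInt_one_pos {c δ₁ δ₂ z₁ z₂ : ℝ} (hc0 : 0 < c) (hc1 : c < 1) (hδ₁ : 0 < δ₁)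
    (hδ₂ : 0 < δ₂) (hz₁ : 0 < z₁) (hz₂ : 0 < z₂) :
    0 < jInt c δ₁ δ₂ z₁ z₂ (fun _ => 1) := by
  unfold jInt
  refine integral_pos_weight (by positivity) hz₂ ?_ ?_
  · exact (jker_continuousOn hc0 hc1 hδ₂ hz₂).mul continuousOn_const
  · intro x hx
    have := kern_pos hδ₂ one_pos hz₁.le (sub_mul_pos hc0 hc1 hz₂ (Ioo_subset_Icc_self hx))
    positivity

/-- The `ε → 0+` limit for a continuous weight. -/
lemma eps_tendsto {c δ₁ δ₂ z₁ z₂ : ℝ} (hc0 : 0 < c) (hc1 : c < 1) (hδ₁ : 0 < δ₁)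
    (hδ₂ : 0 < δ₂) (hz₁ : 0 < z₁) (hz₂ : 0 < z₂) {H : ℝ → ℝ} (hH : ContinuousOn H (Icc 0 z₂)) :
    Tendsto (fun ε => ε ^ (-(δ₁ / 2)) *
      ∫ x₁ in Ioo (0 : ℝ) z₁, x₁ ^ (δ₁ / 2 - 1) * Real.exp (-((1 - c) / 2 * x₁ / ε)) *
        ∫ x₂ in Ioo (0 : ℝ) z₂, x₂ ^ (δ₁ / 2 - 1) * (psiE c δ₁ δ₂ z₁ z₂ (ε, x₁) x₂ * H x₂)) (𝓝[>] 0)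
      (𝓝 (((1 / ((1 - c) / 2)) ^ (δ₁ / 2) * Real.Gamma (δ₁ / 2)) *
        ((z₁ ^ (δ₂ / 2 - 1) * 2 ^ (-(δ₁ / 2)) * gFun (δ₁ / 2 - 1) 0) * jInt c δ₁ δ₂ z₁ z₂ H))) := by
  have ha : 0 < δ₁ / 2 := by positivity
  have hcont : ContinuousOn (Function.uncurry fun ε x₁ => ∫ x₂ in Ioo (0 : ℝ) z₂, x₂ ^ (δ₁ / 2 - 1) *
      (psiE c δ₁ δ₂ z₁ z₂ (ε, x₁) x₂ * H x₂)) (Icc 0 (1 / 2) ×ˢ Icc 0 z₁) := by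
    have := continuousOn_param (K := Icc (0:ℝ) (1 / 2) ×ˢ Icc (0:ℝ) z₁)
      (isCompact_Icc.prod isCompact_Icc) (integrableOn_rpow_Ioo ha hz₂)
      (Ψ := fun p x => psiE c δ₁ δ₂ z₁ z₂ p x * H x)
      ((psiE_continuousOn hc0 hc1 hδ₁ hδ₂ hz₁ hz₂).mul
        (hH.comp (f := fun q : (ℝ × ℝ) × ℝ => q.2) (by fun_prop) fun q hq => hq.2))
    exact this
  have h := approx_identity ha (by linarith : 0 < (1 - c) / 2) hz₁ hcont
  convert h using 3
  unfold jInt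
  rw [← integral_const_mul]
  congr 1
  funext x
  unfold psiE
  simp only [mul_zero, sub_zero, zero_mul, zero_div, mul_one, zero_add]
  ring

/-! ### The inner integral -/

noncomputable def phiL (c δ₁ δ₂ z₂ : ℝ) (p : ℝ × ℝ) (v : ℝ) : ℝ :=
  (2 ^ (-(δ₁ / 2)) * Real.exp (-(p.2 + p.1 * v) / 2) * gFun (δ₁ / 2 - 1) (p.2 * (p.1 * v) / 4)) *
  (2 ^ (-(δ₂ / 2)) * (1 - c * v) ^ (δ₂ / 2 - 1) *
    Real.exp (-((z₂ - c * p.2) + p.1 * (1 - c * v)) / 2) *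
    gFun (δ₂ / 2 - 1) ((z₂ - c * p.2) * (p.1 * (1 - c * v)) / 4))

noncomputable def hL (c δ₁ δ₂ z₂ z₃ x : ℝ) : ℝ :=
  ∫ v in Ioo (0:ℝ) 1, v ^ (δ₁ / 2 - 1) * phiL c δ₁ δ₂ z₂ (z₃, x) v

lemma hL_continuousOn {c δ₁ δ₂ z₂ : ℝ} (hc0 : 0 < c) (hc1 : c < 1) (hδ₁ : 0 < δ₁)
    (hδ₂ : 0 < δ₂) (m : ℝ) :
    ContinuousOn (fun p : ℝ × ℝ => hL c δ₁ δ₂ z₂ p.1 p.2) (Icc 0 m ×ˢ Icc 0 z₂) := by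
  have hg1 := gFun_continuous (by linarith : -1 < δ₁ / 2 - 1)
  have hg2 := gFun_continuous (by linarith : -1 < δ₂ / 2 - 1)
  refine continuousOn_param (K := Icc (0:ℝ) m ×ˢ Icc (0:ℝ) z₂)
      (isCompact_Icc.prod isCompact_Icc) (integrableOn_rpow_Ioo (by positivity) one_pos)
      (Ψ := phiL c δ₁ δ₂ z₂) ?_
  unfold Function.uncurry phiL
  refine ContinuousOn.mul (ContinuousOn.mul (by fun_prop) ?_)
    (ContinuousOn.mul (ContinuousOn.mul (ContinuousOn.mul (by fun_prop) ?_) (by fun_prop)) ?_)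
  · exact hg1.comp_continuousOn (by fun_prop)
  · exact ContinuousOn.rpow_const (by fun_prop)
      fun q hq => Or.inl (sub_mul_pos hc0 hc1 one_pos hq.2).ne'
  · exact hg2.comp_continuousOn (by fun_prop)

lemma inner_eq {c δ₁ δ₂ z₂ z₃ x : ℝ} (hc0 : 0 < c) (hc1 : c < 1)
    (hz₂ : 0 < z₂) (hz₃ : 0 < z₃) (hx : x ∈ Ioo 0 z₂) :
    ∫ x₃ in Ioo (0 : ℝ) z₃, sqBesselP δ₁ 1 x x₃ * sqBesselP δ₂ 1 (z₂ - c * x) (z₃ - c * x₃) =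
      z₃ ^ ((δ₁ + δ₂) / 2 - 1) * hL c δ₁ δ₂ z₂ z₃ x := by
  have h := integral_scale hz₃ zero_le_one
    (fun x₃ => sqBesselP δ₁ 1 x x₃ * sqBesselP δ₂ 1 (z₂ - c * x) (z₃ - c * x₃))
  rw [mul_one] at h
  rw [h]
  unfold hL
  rw [← integral_const_mul, ← integral_const_mul]
  refine setIntegral_congr_fun measurableSet_Ioo fun v hv => ?_
  have hv0 : 0 < v := hv.1
  have e1 := sub_mul_pos hc0 hc1 hz₂ (Ioo_subset_Icc_self hx)
  have e2 := sub_mul_pos hc0 hc1 one_pos (Ioo_subset_Icc_self hv)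
  have e3 : z₃ - c * (z₃ * v) = z₃ * (1 - c * v) := by ring
  beta_reduce
  rw [e3, sqBesselP_eq one_pos hx.1 (by positivity), sqBesselP_eq one_pos e1 (by positivity)]
  unfold kern phiL
  rw [Real.mul_rpow hz₃.le hv0.le, Real.mul_rpow hz₃.le e2.le]
  have e4 : z₃ * (z₃ ^ (δ₁ / 2 - 1) * z₃ ^ (δ₂ / 2 - 1)) = z₃ ^ ((δ₁ + δ₂) / 2 - 1) := by
    nth_rewrite 1 [← Real.rpow_one z₃]
    rw [← Real.rpow_add hz₃, ← Real.rpow_add hz₃]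
    congr 1; ring
  rw [← e4]
  simp only [mul_one, one_pow]
  ring

lemma hL_zero {c δ₁ δ₂ z₂ x : ℝ} :
    hL c δ₁ δ₂ z₂ 0 x = (2 ^ (-(δ₁ / 2)) * gFun (δ₁ / 2 - 1) 0 * (2 ^ (-(δ₂ / 2)) * gFun (δ₂ / 2 - 1) 0) *
      ∫ v in Ioo (0:ℝ) 1, v ^ (δ₁ / 2 - 1) * (1 - c * v) ^ (δ₂ / 2 - 1)) *
      Real.exp (-(z₂ / 2)) * Real.exp (-((1 - c) / 2 * x)) := by
  unfold hL phiL
  have : Real.exp (-(z₂ / 2)) * Real.exp (-((1 - c) / 2 * x)) =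
    Real.exp (-x / 2) * Real.exp (-(z₂ - c * x) / 2) := by
    rw [← Real.exp_add, ← Real.exp_add]; congr 1; ring
  rw [mul_assoc _ (Real.exp _), this, mul_right_comm, ← integral_const_mul]
  congr 1
  funext v
  simp only [zero_mul, mul_zero, add_zero, zero_div]
  ring

lemma jInt_const_mul {c δ₁ δ₂ z₁ z₂ k : ℝ} {H : ℝ → ℝ} :
    jInt c δ₁ δ₂ z₁ z₂ (fun x => k * H x) = k * jInt c δ₁ δ₂ z₁ z₂ H := by
  unfold jInt
  rw [← integral_const_mul]
  congr 1
  funext x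
  ring

lemma jInt_exp {c δ₁ δ₂ r z l : ℝ} (hc0 : 0 < c) (hc1 : c < 1) (hδ₂ : 0 < δ₂)
    (hr : 0 < r) (hz : 0 < z) :
    jInt c δ₁ δ₂ (z * r) z (fun x => Real.exp (-(l * x))) =
      (2 ^ (-(δ₂ / 2)) * z ^ (δ₂ / 2 - 1) * Real.exp (-(z * r + z) / 2) *
        gFun (δ₂ / 2 - 1) (z * r * z / 4)) *
      ∫ x in Ioo 0 z, x ^ (δ₁ / 2 - 1) * Real.exp (-(((1 - c) / 2 + l) * x)) *
      ((1 - c * x / z) ^ (δ₂ / 2 - 1) * (gFun (δ₂ / 2 - 1) (z * r * (z - c * x) / 4) /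
        gFun (δ₂ / 2 - 1) (z * r * z / 4))) := by
  unfold jInt
  rw [← integral_const_mul]
  refine setIntegral_congr_fun measurableSet_Ioo fun x hx => ?_
  have e1 := sub_mul_pos hc0 hc1 hz (Ioo_subset_Icc_self hx)
  have g1 : gFun (δ₂ / 2 - 1) (z * r * z / 4) ≠ 0 := (gFun_pos (by linarith) (by positivity)).ne'
  beta_reduce
  unfold kern
  simp only [mul_one, one_pow]
  have e2 : z - c * x = z * (1 - c * x / z) := by field_simp
  have e3 : 0 ≤ 1 - c * x / z := by
    rw [e2] at e1
    exact (pos_of_mul_pos_right e1 hz.le).le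
  have e4 : (z - c * x) ^ (δ₂ / 2 - 1) = z ^ (δ₂ / 2 - 1) * (1 - c * x / z) ^ (δ₂ / 2 - 1) := by
    rw [e2, Real.mul_rpow hz.le e3]
  rw [e4]
  have e5 : Real.exp (-x / 2) * Real.exp (-(z * r + (z - c * x)) / 2) * Real.exp (-(l * x)) =
      Real.exp (-(z * r + z) / 2) * Real.exp (-(((1 - c) / 2 + l) * x)) := by
    rw [← Real.exp_add, ← Real.exp_add, ← Real.exp_add]; congr 1; ring
  have e6' : gFun (δ₂ / 2 - 1) (z * r * z / 4) * (gFun (δ₂ / 2 - 1) (z * r * (z - c * x) / 4) /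
      gFun (δ₂ / 2 - 1) (z * r * z / 4)) = gFun (δ₂ / 2 - 1) (z * r * (z - c * x) / 4) := by
    rw [mul_comm, div_mul_cancel₀ _ g1]
  generalize gFun (δ₂ / 2 - 1) (z * r * (z - c * x) / 4) / gFun (δ₂ / 2 - 1) (z * r * z / 4) = Q at *
  linear_combination (x ^ (δ₁ / 2 - 1) * z ^ (δ₂ / 2 - 1) * 2 ^ (-(δ₂ / 2)) * (1 - c * x / z) ^ (δ₂ / 2 - 1) *
    gFun (δ₂ / 2 - 1) (z * r * (z - c * x) / 4)) * e5 -
    (x ^ (δ₁ / 2 - 1) * z ^ (δ₂ / 2 - 1) * 2 ^ (-(δ₂ / 2)) * (1 - c * x / z) ^ (δ₂ / 2 - 1) *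
    (Real.exp (-(z * r + z) / 2) * Real.exp (-(((1 - c) / 2 + l) * x)))) * e6'

/-- **Theorem (Statement 15).** For `0 < c < 1` and `δ₁, δ₂ > 0` there is a positive
constant `C₃`, depending only on `δ₁`, `δ₂` and `c`, such that for every `r > 0`,
`lim_{z₂→∞} e^{z₂/2} lim_{z₃→0+} z₃^{1−(δ₁+δ₂)/2} lim_{ε→0+} q(z₂,z₃;ε,z₂r)/q(z₂;ε,z₂r)
 = C₃ D(r)^{−δ₁/2}` where `D(r) = 1 + (1−c)/(1−c+c√r)`; in particular, since
`r ↦ D(r)^{−δ₁/2}` is non-constant, this iterated limit depends on `r`. -/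
theorem statement15 (c δ₁ δ₂ : ℝ) (hc0 : 0 < c) (hc1 : c < 1)
    (hδ₁ : 0 < δ₁) (hδ₂ : 0 < δ₂) :
    ∃ C₃ : ℝ, 0 < C₃ ∧
      (∀ r : ℝ, 0 < r → ∃ g : ℝ → ℝ → ℝ, ∃ h : ℝ → ℝ,
        (∀ z₂ : ℝ, 0 < z₂ → ∀ z₃ : ℝ, 0 < z₃ →
          Tendsto (fun ε => qThreeE c δ₁ δ₂ ε (z₂ * r) z₂ z₃ / qTwoE c δ₁ δ₂ ε (z₂ * r) z₂)
            (𝓝[>] 0) (𝓝 (g z₂ z₃))) ∧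
        (∀ z₂ : ℝ, 0 < z₂ →
          Tendsto (fun z₃ => z₃ ^ (1 - (δ₁ + δ₂) / 2) * g z₂ z₃) (𝓝[>] 0) (𝓝 (h z₂))) ∧
        Tendsto (fun z₂ => Real.exp (z₂ / 2) * h z₂) atTop
          (𝓝 (C₃ * (1 + (1 - c) / (1 - c + c * Real.sqrt r)) ^ (-(δ₁ / 2))))) ∧
      ∃ r₁ r₂ : ℝ, 0 < r₁ ∧ 0 < r₂ ∧
        C₃ * (1 + (1 - c) / (1 - c + c * Real.sqrt r₁)) ^ (-(δ₁ / 2)) ≠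
        C₃ * (1 + (1 - c) / (1 - c + c * Real.sqrt r₂)) ^ (-(δ₁ / 2)) := by
  have ha : 0 < δ₁ / 2 := by positivity
  have hν₁ : -1 < δ₁ / 2 - 1 := by linarith
  have hν₂ : -1 < δ₂ / 2 - 1 := by linarith
  have hc' : 0 < 1 - c := by linarith
  obtain ⟨B, hB⟩ : ∃ B : ℝ, B = 2 ^ (-(δ₁ / 2)) * gFun (δ₁ / 2 - 1) 0 * (2 ^ (-(δ₂ / 2)) * gFun (δ₂ / 2 - 1) 0) *
      ∫ v in Ioo (0:ℝ) 1, v ^ (δ₁ / 2 - 1) * (1 - c * v) ^ (δ₂ / 2 - 1) := ⟨_, rfl⟩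
  have hBpos : 0 < B := by
    have g1 := gFun_pos hν₁ le_rfl
    have g2 := gFun_pos hν₂ le_rfl
    have hI : 0 < ∫ v in Ioo (0:ℝ) 1, v ^ (δ₁ / 2 - 1) * (1 - c * v) ^ (δ₂ / 2 - 1) := by
      refine integral_pos_weight ha one_pos ?_ ?_
      · exact ContinuousOn.rpow_const (by fun_prop)
          fun q hq => Or.inl (sub_mul_pos hc0 hc1 one_pos hq).ne'
      · intro v hv
        exact Real.rpow_pos_of_pos (sub_mul_pos hc0 hc1 one_pos (Ioo_subset_Icc_self hv)) _
    rw [hB]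
    positivity
  refine ⟨B, hBpos, ?_, ?_⟩
  · intro r hr
    have hsr : 0 < √r := Real.sqrt_pos.2 hr
    refine ⟨fun z₂ z₃ => jInt c δ₁ δ₂ (z₂ * r) z₂
        (fun x => z₃ ^ ((δ₁ + δ₂) / 2 - 1) * hL c δ₁ δ₂ z₂ z₃ x) /
        jInt c δ₁ δ₂ (z₂ * r) z₂ (fun _ => 1),
      fun z₂ => jInt c δ₁ δ₂ (z₂ * r) z₂ (hL c δ₁ δ₂ z₂ 0) /
        jInt c δ₁ δ₂ (z₂ * r) z₂ (fun _ => 1), ?_, ?_, ?_⟩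
    · intro z₂ hz₂ z₃ hz₃
      have hz₁ : 0 < z₂ * r := by positivity
      have hH : ContinuousOn (fun x => z₃ ^ ((δ₁ + δ₂) / 2 - 1) * hL c δ₁ δ₂ z₂ z₃ x) (Icc 0 z₂) := by
        refine continuousOn_const.mul ?_
        exact (hL_continuousOn (z₂ := z₂) hc0 hc1 hδ₁ hδ₂ z₃).comp (f := fun x => (z₃, x)) (by fun_prop)
          fun x hx => ⟨⟨hz₃.le, le_rfl⟩, hx⟩
      have t3 := eps_tendsto hc0 hc1 hδ₁ hδ₂ hz₁ hz₂ hH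
      have t2 := eps_tendsto hc0 hc1 hδ₁ hδ₂ hz₁ hz₂ (continuousOn_const (c := (1:ℝ)))
      have hJ := jInt_one_pos hc0 hc1 hδ₁ hδ₂ hz₁ hz₂
      have k1 : 0 < (1 / ((1 - c) / 2)) ^ (δ₁ / 2) * Real.Gamma (δ₁ / 2) := by
        have := Real.Gamma_pos_of_pos ha
        positivity
      have k2 : 0 < (z₂ * r) ^ (δ₂ / 2 - 1) * 2 ^ (-(δ₁ / 2)) * gFun (δ₁ / 2 - 1) 0 := by
        have := gFun_pos hν₁ le_rfl
        positivity
      have t := t3.div t2 (by positivity)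
      rw [mul_div_mul_left _ _ k1.ne', mul_div_mul_left _ _ k2.ne'] at t
      refine t.congr' ?_
      filter_upwards [Ioo_mem_nhdsGT (one_pos : (0:ℝ) < 1)] with ε hε
      have hε0 : 0 < ε := hε.1
      have q3 : qThreeE c δ₁ δ₂ ε (z₂ * r) z₂ z₃ = _ :=
        Eq.trans ?_ (eps_eq (δ₁ := δ₁) (δ₂ := δ₂) hc0 hc1 hz₁ hz₂ hε.1 hε.2
          (fun x => z₃ ^ ((δ₁ + δ₂) / 2 - 1) * hL c δ₁ δ₂ z₂ z₃ x))
      have q2 : qTwoE c δ₁ δ₂ ε (z₂ * r) z₂ = _ :=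
        Eq.trans ?_ (eps_eq (δ₁ := δ₁) (δ₂ := δ₂) hc0 hc1 hz₁ hz₂ hε.1 hε.2 (fun _ => 1))
      · rw [q3, q2]
        have p1 : 0 < ε ^ (-(δ₁ / 2)) := by positivity
        have p2 : 0 < (Real.exp (-(z₂ * r / (2 * ε))) / (((2 * ε) ^ (δ₁ / 2) * Real.Gamma (δ₁ / 2)) *
            ((2 * ε) ^ (δ₂ / 2) * Real.Gamma (δ₂ / 2)))) := by
          have := Real.Gamma_pos_of_pos ha
          have := Real.Gamma_pos_of_pos (by positivity : 0 < δ₂ / 2)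
          positivity
        rw [Pi.div_apply, mul_div_mul_left _ _ p1.ne', mul_div_mul_left _ _ p2.ne']
      · unfold qTwoE
        simp only [mul_one]
      · unfold qThreeE
        congr 1
        funext x₁
        refine setIntegral_congr_fun measurableSet_Ioo fun x₂ hx₂ => ?_
        beta_reduce
        rw [← inner_eq hc0 hc1 hz₂ hz₃ hx₂, ← integral_const_mul]
        congr 1
        funext x₃
        ring
    · intro z₂ hz₂
      have hcont : ContinuousOn (fun z₃ => jInt c δ₁ δ₂ (z₂ * r) z₂ (hL c δ₁ δ₂ z₂ z₃)) (Icc 0 1) := by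
        refine continuousOn_param (K := Icc (0:ℝ) 1) isCompact_Icc (integrableOn_rpow_Ioo ha hz₂)
          (Ψ := fun z₃ x => Real.exp (-x / 2) * kern δ₂ 1 (z₂ * r) (z₂ - c * x) * hL c δ₁ δ₂ z₂ z₃ x) ?_
        refine ContinuousOn.mul ?_ (hL_continuousOn hc0 hc1 hδ₁ hδ₂ 1)
        exact (jker_continuousOn (z₁ := z₂ * r) hc0 hc1 hδ₂ hz₂).comp (f := fun q : ℝ × ℝ => q.2)
          (by fun_prop) fun q hq => hq.2
      have t := (hcont 0 ⟨le_rfl, zero_le_one⟩)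
      have t' : Tendsto (fun z₃ => jInt c δ₁ δ₂ (z₂ * r) z₂ (hL c δ₁ δ₂ z₂ z₃)) (𝓝[>] 0)
          (𝓝 (jInt c δ₁ δ₂ (z₂ * r) z₂ (hL c δ₁ δ₂ z₂ 0))) := by
        refine t.tendsto.mono_left ?_
        rw [← nhdsWithin_Ioo_eq_nhdsGT (zero_lt_one' ℝ)]
        exact nhdsWithin_mono _ Ioo_subset_Icc_self
      refine (t'.div_const _).congr' ?_
      filter_upwards [self_mem_nhdsWithin] with z₃ hz₃
      have hz : 0 < z₃ := hz₃
      beta_reduce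
      rw [jInt_const_mul, ← mul_div_assoc, ← mul_assoc, ← Real.rpow_add hz]
      simp
    · have tn := laplace_limit (κ := (1 - c) / 2 + (1 - c) / 2) hν₂ ha hc0 hc1 hr (by linarith)
      have td := laplace_limit (κ := (1 - c) / 2 + 0) hν₂ ha hc0 hc1 hr (by linarith)
      have hG := Real.Gamma_pos_of_pos ha
      have t := (tn.div td (by positivity)).const_mul B
      have hval : (1 / ((1 - c) / 2 + (1 - c) / 2 + c * √r / 2)) ^ (δ₁ / 2) * Real.Gamma (δ₁ / 2) /
          ((1 / ((1 - c) / 2 + 0 + c * √r / 2)) ^ (δ₁ / 2) * Real.Gamma (δ₁ / 2)) =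
          (1 + (1 - c) / (1 - c + c * √r)) ^ (-(δ₁ / 2)) := by
        rw [mul_div_mul_right _ _ hG.ne', ← Real.div_rpow (by positivity) (by positivity),
          Real.rpow_neg (by positivity), ← Real.inv_rpow (by positivity)]
        congr 1
        have : 0 < c * √r := by positivity
        field_simp
        ring
      rw [hval] at t
      refine t.congr' ?_
      filter_upwards [eventually_gt_atTop 0] with z hz
      have hz₁ : 0 < z * r := by positivity
      have e0 : hL c δ₁ δ₂ z 0 = fun x => (B * Real.exp (-(z / 2))) * Real.exp (-((1 - c) / 2 * x)) := by
        funext x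
        rw [hL_zero, hB]
      have e1 : (fun _ : ℝ => (1:ℝ)) = fun x => Real.exp (-(0 * x)) := by
        funext x; simp
      have g1 := gFun_pos hν₂ (by positivity : 0 ≤ z * r * z / 4)
      have p : 0 < (2 ^ (-(δ₂ / 2)) * z ^ (δ₂ / 2 - 1) * Real.exp (-(z * r + z) / 2) *
        gFun (δ₂ / 2 - 1) (z * r * z / 4)) := by positivity
      rw [e0, jInt_const_mul, e1, jInt_exp hc0 hc1 hδ₂ hr hz, jInt_exp hc0 hc1 hδ₂ hr hz]
      rw [mul_div_assoc, mul_div_mul_left _ _ p.ne', Pi.div_apply]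
      have hee : Real.exp (z / 2) * Real.exp (-(z / 2)) = 1 := by
        rw [← Real.exp_add]; simp
      rw [← mul_assoc, ← mul_assoc, mul_right_comm (Real.exp (z / 2)), hee, one_mul]
  · refine ⟨1, 4, one_pos, by norm_num, ?_⟩
    intro h
    have h1 := mul_left_cancel₀ hBpos.ne' h
    have s4 : √(4:ℝ) = 2 := by
      rw [show (4:ℝ) = 2 ^ 2 by norm_num, Real.sqrt_sq (by norm_num)]
    rw [Real.sqrt_one, s4] at h1
    have hlt : 1 + (1 - c) / (1 - c + c * 2) < 1 + (1 - c) / (1 - c + c * 1) := by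
      gcongr
      norm_num
    exact (Real.rpow_lt_rpow_of_neg (by positivity) hlt (by linarith : -(δ₁ / 2) < 0)).ne' h1.symm
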